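/- The symmetric group S_n admits a presentation with two generators σ₁ and σ and relations: σ₁σⁱσ₁σ⁻ⁱ = σⁱσ₁σ⁻ⁱσ₁ for 2 ≤ i ≤ n/2; σⁿ = (σσ₁)ⁿ⁻¹; σ₁² = 1. The isomorphism sends σ₁ to the transposition (1 2) and σ to the n-cycle (1 2 … n). -/

import Mathlib

/-- Relators of the two-generator presentation of the symmetric group `S_n`:
generator `true` is `σ₁`, generator `false` is `σ`; relations
`σ₁σⁱσ₁σ⁻ⁱ = σⁱσ₁σ⁻ⁱσ₁` for `2 ≤ i ≤ n/2`, `σⁿ = (σσ₁)ⁿ⁻¹`, and `σ₁² = 1`. -/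
def symTwoGenRels (n : ℕ) : Set (FreeGroup Bool) :=
  {r | ∃ i : ℕ, 2 ≤ i ∧ i ≤ n / 2 ∧
      r = .of true * (.of false) ^ i * .of true * ((.of false : FreeGroup Bool) ^ i)⁻¹ *
        ((.of false : FreeGroup Bool) ^ i * .of true * ((.of false : FreeGroup Bool) ^ i)⁻¹ *
          .of true)⁻¹} ∪
  {(.of false : FreeGroup Bool) ^ n * ((.of false * .of true : FreeGroup Bool) ^ (n - 1))⁻¹} ∪
  {(.of true : FreeGroup Bool) ^ 2}

namespace SymPres

section cox
variable {G : Type*} [Group G]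

/-- descending product `b (j+k-1) * ... * b j` -/
def D (b : ℕ → G) (j : ℕ) : ℕ → G
  | 0 => 1
  | k + 1 => b (j + k) * D b j k

/-- ascending product `b j * ... * b (j+k-1)` -/
def A (b : ℕ → G) (j : ℕ) : ℕ → G
  | 0 => 1
  | k + 1 => A b j k * b (j + k)

lemma D_comm (b : ℕ → G) (j k : ℕ) (g : G) (h : ∀ l, l < k → b (j + l) * g = g * b (j + l)) :
    D b j k * g = g * D b j k := by
  induction k with
  | zero => simp [D]
  | succ k ih =>
    simp only [D]
    rw [mul_assoc, ih (fun l hl => h l (by omega)), ← mul_assoc, h k (by omega), mul_assoc]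

lemma D_low (b : ℕ → G) (j k : ℕ) : D b (j + 1) k * b j = D b j (k + 1) := by
  induction k with
  | zero => simp [D]
  | succ k ih =>
    rw [D, mul_assoc, ih, D, D]
    rw [show j + 1 + k = j + (k + 1) by ring]
    simp [D]

lemma D_mid (N : ℕ) (b : ℕ → G)
    (hbr : ∀ i, i + 1 < N → b i * b (i + 1) * b i = b (i + 1) * b i * b (i + 1))
    (hc : ∀ i j, i + 2 ≤ j → j < N → b i * b j = b j * b i) (j i : ℕ) (hi : j < i + 1) (k : ℕ)
    (hk : i + 1 < j + k) (hN : j + k ≤ N) :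
    D b j k * b (i + 1) = b i * D b j k := by
  induction k with
  | zero => omega
  | succ k ih =>
    rcases Nat.lt_or_ge (i + 1) (j + k) with h | h
    · rw [D, mul_assoc, ih h (by omega), ← mul_assoc, ← hc i (j + k) (by omega) (by omega),
        mul_assoc]
    · obtain ⟨k', rfl⟩ : ∃ k', k = k' + 1 := ⟨k - 1, by omega⟩
      have e : i = j + k' := by omega
      subst e
      have e1 : D b j k' * b (j + k' + 1) = b (j + k' + 1) * D b j k' :=
        D_comm b j k' _ (fun l hl => hc _ _ (by omega) (by omega))
      simp only [D]
      rw [mul_assoc, mul_assoc, e1, ← add_assoc]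
      have := hbr (j + k') (by omega)
      simp only [← mul_assoc]
      rw [this]

open Classical in
/-- normal forms -/
noncomputable def T (b : ℕ → G) : ℕ → Finset G
  | 0 => {1}
  | m + 1 => Finset.image (fun p : G × ℕ => p.1 * D b (m + 1 - p.2) p.2)
      (T b m ×ˢ Finset.range (m + 2))

lemma T_card (b : ℕ → G) (m : ℕ) : (T b m).card ≤ (m + 1).factorial := by
  induction m with
  | zero => simp [T]
  | succ m ih =>
    classical
    rw [T]
    refine Finset.card_image_le.trans ?_
    rw [Finset.card_product, Finset.card_range, Nat.factorial_succ (m + 1), mul_comm]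
    gcongr

lemma mem_T_succ (b : ℕ → G) (m : ℕ) (x : G) : x ∈ T b (m + 1) ↔
    ∃ t ∈ T b m, ∃ k j, j + k = m + 1 ∧ x = t * D b j k := by
  simp only [T, Finset.mem_image, Finset.mem_product, Finset.mem_range, Prod.exists]
  constructor
  · rintro ⟨t, k, ⟨ht, hk⟩, rfl⟩
    exact ⟨t, ht, k, m + 1 - k, by omega, rfl⟩
  · rintro ⟨t, ht, k, j, h, rfl⟩
    exact ⟨t, k, ⟨ht, by omega⟩, by rw [show m + 1 - k = j by omega]⟩

lemma one_mem_T (b : ℕ → G) (m : ℕ) : 1 ∈ T b m := by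
  induction m with
  | zero => simp [T]
  | succ m ih => exact (mem_T_succ b m 1).2 ⟨1, ih, 0, m + 1, rfl, by simp [D]⟩

lemma T_stable (N : ℕ) (b : ℕ → G) (hsq : ∀ i, b i * b i = 1)
    (hbr : ∀ i, i + 1 < N → b i * b (i + 1) * b i = b (i + 1) * b i * b (i + 1))
    (hc : ∀ i j, i + 2 ≤ j → j < N → b i * b j = b j * b i) (m : ℕ) (hm : m ≤ N) :
    ∀ i, i < m → ∀ x ∈ T b m, x * b i ∈ T b m := by
  induction m with
  | zero => intro i hi; omega
  | succ m ih =>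
    intro i hi x hx
    obtain ⟨t, ht, k, j, hj, rfl⟩ := (mem_T_succ b m x).1 hx
    refine (mem_T_succ b m _).2 ?_
    rcases Nat.lt_trichotomy (i + 1) j with h | h | h
    · refine ⟨t * b i, ih (by omega) i (by omega) t ht, k, j, hj, ?_⟩
      rw [mul_assoc, D_comm b j k (b i), mul_assoc]
      intro l hl
      exact (hc _ _ (by omega) (by omega)).symm
    · subst h
      exact ⟨t, ht, k + 1, i, by omega, by rw [mul_assoc, D_low]⟩
    · rcases Nat.eq_or_lt_of_le (Nat.lt_succ_iff.1 h) with h | h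
      · subst h
        obtain ⟨k', rfl⟩ : ∃ k', k = k' + 1 := ⟨k - 1, by omega⟩
        exact ⟨t, ht, k', j + 1, by omega, by
          rw [← D_low, mul_assoc, mul_assoc, hsq, mul_one]⟩
      · obtain ⟨i, rfl⟩ : ∃ i', i = i' + 1 := ⟨i - 1, by omega⟩
        refine ⟨t * b i, ih (by omega) i (by omega) t ht, k, j, hj, ?_⟩
        rw [mul_assoc, D_mid N b hbr hc j i h k (by omega) (by omega), mul_assoc]

lemma T_univ (N : ℕ) (b : ℕ → G) (hsq : ∀ i, b i * b i = 1)
    (hbr : ∀ i, i + 1 < N → b i * b (i + 1) * b i = b (i + 1) * b i * b (i + 1))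
    (hc : ∀ i j, i + 2 ≤ j → j < N → b i * b j = b j * b i)
    (hgen : Subgroup.closure (b '' Set.Iio N) = ⊤) (x : G) : x ∈ T b N := by
  have hx : x ∈ Subgroup.closure (b '' Set.Iio N) := by rw [hgen]; trivial
  induction hx using Subgroup.closure_induction_right with
  | one => exact one_mem_T b N
  | mul_right x y hy z ih =>
    obtain ⟨i, hi, rfl⟩ := z
    exact T_stable N b hsq hbr hc N le_rfl i hi _ ih
  | mul_inv_cancel x y hy z ih =>
    obtain ⟨i, hi, rfl⟩ := z
    rw [inv_eq_of_mul_eq_one_right (hsq i)]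
    exact T_stable N b hsq hbr hc N le_rfl i hi _ ih

lemma A_comm (b : ℕ → G) (j k : ℕ) (g : G) (h : ∀ l, l < k → g * b (j + l) = b (j + l) * g) :
    A b j k * g = g * A b j k := by
  induction k with
  | zero => simp [A]
  | succ k ih =>
    simp only [A]
    rw [mul_assoc, ← h k (by omega), ← mul_assoc, ih (fun l hl => h l (by omega)), mul_assoc]

lemma A_low (b : ℕ → G) (j k : ℕ) : b j * A b (j + 1) k = A b j (k + 1) := by
  induction k with
  | zero => simp [A]
  | succ k ih =>
    rw [A, ← mul_assoc, ih, A, A, A]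
    rw [show j + 1 + k = j + (k + 1) by ring]

/-- conjugates -/
def B (s a : G) (i : ℕ) : G := s ^ i * a * (s ^ i)⁻¹

lemma B_succ (s a : G) (i : ℕ) : s * B s a i = B s a (i + 1) * s := by
  simp only [B, pow_succ', mul_inv_rev]; group

lemma pow_A (s a : G) (k : ℕ) : (s * a) ^ k = A (B s a) 1 k * s ^ k := by
  induction k with
  | zero => simp [A]
  | succ k ih =>
    rw [pow_succ, ih, A, B, add_comm 1 k, pow_succ]
    group

lemma s_A (s a : G) (j k : ℕ) : s * A (B s a) j k = A (B s a) (j + 1) k * s := by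
  induction k with
  | zero => simp [A]
  | succ k ih =>
    rw [A, ← mul_assoc, ih, A, mul_assoc, B_succ, ← mul_assoc, show j + k + 1 = j + 1 + k by ring]

lemma B_comm_shift (s a : G) (d : ℕ) (h : a * B s a d = B s a d * a) (i : ℕ) :
    B s a i * B s a (i + d) = B s a (i + d) * B s a i := by
  have e : B s a (i + d) = s ^ i * B s a d * (s ^ i)⁻¹ := by simp only [B, pow_add]; group
  rw [e]
  calc B s a i * (s ^ i * B s a d * (s ^ i)⁻¹) = s ^ i * (a * B s a d) * (s ^ i)⁻¹ := by
        simp only [B]; group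
    _ = s ^ i * (B s a d * a) * (s ^ i)⁻¹ := by rw [h]
    _ = _ := by simp only [B]; group

lemma all_in (n : ℕ) (hn : 2 ≤ n) (s a : G) (ha : a ^ 2 = 1)
    (hz : s ^ n = (s * a) ^ (n - 1))
    (hr : ∀ i, 2 ≤ i → i ≤ n / 2 → a * B s a i = B s a i * a)
    (hgen : Subgroup.closure {s, a} = ⊤) (x : G) : x ∈ T (B s a) (n - 1) := by
  obtain ⟨m, rfl⟩ : ∃ m, n = m + 2 := ⟨n - 2, by omega⟩
  simp only [show m + 2 - 1 = m + 1 by omega] at *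
  have hsA1 : s = A (B s a) 1 (m + 1) := by
    rw [pow_A, pow_succ' s (m + 1)] at hz
    exact mul_right_cancel hz
  have hsA : s = A (B s a) 0 (m + 1) := by
    have h := s_A s a 0 (m + 1)
    rw [zero_add, ← hsA1] at h
    exact (mul_left_cancel h).symm
  have hza : a * s ^ (m + 2) = s ^ (m + 2) * a := by
    have h1 : Commute (s ^ (m + 2)) (s * a) := by
      rw [hz]; exact (Commute.refl _).pow_left _
    have h2 : Commute (s ^ (m + 2)) s := (Commute.refl _).pow_left _
    have h3 := (h2.inv_right).mul_right h1
    rw [inv_mul_cancel_left] at h3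
    exact h3.eq.symm
  have hper : B s a (m + 2) = a := by
    rw [B, ← hza]; group
  have hc0 : ∀ d, 2 ≤ d → d ≤ m → a * B s a d = B s a d * a := by
    intro d h2 hd
    rcases Nat.lt_or_ge ((m + 2) / 2) d with h | h
    · have := B_comm_shift s a (m + 2 - d) (hr _ (by omega) (by omega)) d
      rw [show d + (m + 2 - d) = m + 2 by omega, hper] at this
      exact this.symm
    · exact hr d h2 h
  have hc : ∀ i j, i + 2 ≤ j → j < m + 1 → B s a i * B s a j = B s a j * B s a i := by
    intro i j h1 h2
    have := B_comm_shift s a (j - i) (hc0 _ (by omega) (by omega)) i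
    rwa [show i + (j - i) = j by omega] at this
  have hsq : ∀ i, B s a i * B s a i = 1 := by
    intro i
    calc _ = s ^ i * a ^ 2 * (s ^ i)⁻¹ := by simp only [B, pow_two]; group
      _ = 1 := by rw [ha]; group
  have hbr0 : 1 < m + 1 → a * B s a 1 * a = B s a 1 * a * B s a 1 := by
    intro h
    obtain ⟨k, rfl⟩ : ∃ k, m = k + 1 := ⟨m - 1, by omega⟩
    have h0 : B s a 0 = a := by simp [B]
    have e : s = a * B s a 1 * A (B s a) 2 k := by
      conv_lhs => rw [hsA]
      rw [← A_low, ← A_low, h0, mul_assoc]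
    have e2 : A (B s a) 2 k * a = a * A (B s a) 2 k :=
      A_comm _ _ _ _ (fun l hl => hc0 _ (by omega) (by omega))
    have e3 := B_succ s a 0
    rw [h0, zero_add] at e3
    generalize A (B s a) 2 k = P at e e2
    generalize B s a 1 = c at *
    rw [e, mul_assoc _ P a, e2] at e3
    apply mul_right_cancel (b := P)
    rw [← mul_assoc] at e3
    rw [e3]; group
  have hbr : ∀ i, i + 1 < m + 1 → B s a i * B s a (i + 1) * B s a i =
      B s a (i + 1) * B s a i * B s a (i + 1) := by
    intro i hi
    have e : B s a (i + 1) = s ^ i * B s a 1 * (s ^ i)⁻¹ := by simp only [B, pow_add]; group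
    rw [e]
    calc _ = s ^ i * (a * B s a 1 * a) * (s ^ i)⁻¹ := by simp only [B]; group
      _ = s ^ i * (B s a 1 * a * B s a 1) * (s ^ i)⁻¹ := by rw [hbr0 (by omega)]
      _ = _ := by simp only [B]; group
  refine T_univ (m + 1) _ hsq hbr hc ?_ x
  have hmem : ∀ i, i < m + 1 → B s a i ∈ Subgroup.closure (B s a '' Set.Iio (m + 1)) :=
    fun i hi => Subgroup.subset_closure ⟨i, hi, rfl⟩
  have hA : ∀ k, k ≤ m + 1 → A (B s a) 0 k ∈ Subgroup.closure (B s a '' Set.Iio (m + 1)) := by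
    intro k hk
    induction k with
    | zero => exact Subgroup.one_mem _
    | succ k ih => exact Subgroup.mul_mem _ (ih (by omega)) (hmem _ (by omega))
  rw [eq_top_iff, ← hgen, Subgroup.closure_le]
  rintro y (rfl | rfl)
  · have := hA (m + 1) le_rfl
    rwa [← hsA] at this
  · have := hmem 0 (by omega)
    simpa [B] using this

end cox

lemma tau_pow (m : ℕ) :
    (finRotate (m + 2) * Equiv.swap ⟨0, by omega⟩ ⟨1, by omega⟩ : Equiv.Perm (Fin (m + 2))) ^ (m + 1)
      = 1 := by
  rcases m with _ | m
  · decide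
  set τ : Equiv.Perm (Fin (m + 1 + 2)) :=
    finRotate (m + 1 + 2) * Equiv.swap ⟨0, by omega⟩ ⟨1, by omega⟩ with hτ
  have h0 : τ ⟨0, by omega⟩ = ⟨2, by omega⟩ := by
    rw [hτ, Equiv.Perm.mul_apply, Equiv.swap_apply_left]
    exact finRotate_of_lt (k := 1) (by omega)
  have h1 : τ ⟨1, by omega⟩ = ⟨1, by omega⟩ := by
    rw [hτ, Equiv.Perm.mul_apply, Equiv.swap_apply_right]
    exact finRotate_of_lt (k := 0) (by omega)
  have h2 : ∀ k (hk : k + 3 < m + 1 + 2), τ ⟨k + 2, by omega⟩ = ⟨k + 3, hk⟩ := by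
    intro k hk
    rw [hτ, Equiv.Perm.mul_apply, Equiv.swap_apply_of_ne_of_ne (by simp) (by simp)]
    exact finRotate_of_lt (k := k + 2) (by omega)
  have h3 : τ ⟨m + 2, by omega⟩ = ⟨0, by omega⟩ := by
    rw [hτ, Equiv.Perm.mul_apply, Equiv.swap_apply_of_ne_of_ne (by simp) (by simp)]
    exact finRotate_last'
  have hp : ∀ k (hk : k + 2 < m + 1 + 2), (τ ^ (k + 1)) ⟨0, by omega⟩ = ⟨k + 2, hk⟩ := by
    intro k
    induction k with
    | zero => intro hk; simpa using h0
    | succ k ih =>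
      intro hk
      rw [pow_succ', Equiv.Perm.mul_apply, ih (by omega)]
      exact h2 k (by omega)
  have hl : (τ ^ (m + 1 + 1)) ⟨0, by omega⟩ = ⟨0, by omega⟩ := by
    rw [pow_succ', Equiv.Perm.mul_apply, hp m (by omega), h3]
  ext1 ⟨x, hx⟩
  rw [Equiv.Perm.one_apply]
  rcases x with _ | _ | x
  · exact hl
  · exact Function.IsFixedPt.perm_pow h1 _
  · rw [← hp x hx, ← Equiv.Perm.mul_apply, ← pow_add, add_comm (m + 1 + 1) (x + 1), pow_add, Equiv.Perm.mul_apply, hl]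

lemma rot_pow (m i : ℕ) (x : Fin (m + 2)) :
    (((finRotate (m + 2)) ^ i) x).val = (x.val + i) % (m + 2) := by
  induction i with
  | zero => simp [Nat.mod_eq_of_lt x.2]
  | succ i ih =>
    rw [pow_succ', Equiv.Perm.mul_apply, finRotate_apply, Fin.val_add, ih]
    simp [add_assoc]

lemma perm_comm (m i : ℕ) (h2 : 2 ≤ i) (hi : i ≤ (m + 2) / 2) :
    let a : Equiv.Perm (Fin (m + 2)) := Equiv.swap ⟨0, by omega⟩ ⟨1, by omega⟩
    a * B (finRotate (m + 2)) a i = B (finRotate (m + 2)) a i * a := by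
  intro a
  have e : B (finRotate (m + 2)) a i = Equiv.swap (((finRotate (m + 2)) ^ i) ⟨0, by omega⟩)
      (((finRotate (m + 2)) ^ i) ⟨1, by omega⟩) := by
    rw [B, Equiv.swap_apply_apply]
  rw [e]
  have v0 := rot_pow m i ⟨0, by omega⟩
  have v1 := rot_pow m i ⟨1, by omega⟩
  rw [Nat.mod_eq_of_lt (by simp; omega)] at v0 v1
  simp only at v0 v1
  refine (Equiv.Perm.Disjoint.commute ?_).eq
  apply Equiv.Perm.disjoint_swap_swap
  generalize ((finRotate (m + 2)) ^ i) ⟨0, by omega⟩ = p at *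
  generalize ((finRotate (m + 2)) ^ i) ⟨1, by omega⟩ = q at *
  simp only [List.nodup_cons, List.mem_cons, List.not_mem_nil, or_false, Fin.ext_iff, v0, v1,
    not_false_eq_true, List.nodup_nil, and_true]
  omega

end SymPres

/-- The symmetric group `S_n` admits the two-generator presentation, the isomorphism
sending `σ₁` to the transposition `(1 2)` and `σ` to the `n`-cycle `(1 2 … n)`. -/
theorem two_generator_presentation_of_symmetric_group (n : ℕ) (hn : 2 ≤ n) :
    ∃ e : PresentedGroup (symTwoGenRels n) ≃* Equiv.Perm (Fin n),
      e (.of true) = Equiv.swap ⟨0, by omega⟩ ⟨1, by omega⟩ ∧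
      e (.of false) = finRotate n := by
  classical
  obtain ⟨m, rfl⟩ : ∃ m, n = m + 2 := ⟨n - 2, by omega⟩
  set a : Equiv.Perm (Fin (m + 2)) := Equiv.swap ⟨0, by omega⟩ ⟨1, by omega⟩ with ha
  let f : Bool → Equiv.Perm (Fin (m + 2)) := fun b => if b then a else finRotate (m + 2)
  have hf : ∀ r ∈ symTwoGenRels (m + 2), FreeGroup.lift f r = 1 := by
    rintro r ((⟨i, h2, hi, rfl⟩ | rfl) | rfl)
    · have := SymPres.perm_comm m i h2 hi
      simp only [SymPres.B, ← ha] at this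
      simp only [map_mul, map_inv, map_pow, FreeGroup.lift_apply_of, f, if_true,
        Bool.false_eq_true, if_false]
      rw [mul_inv_eq_one, ← this]
      simp only [mul_assoc]
    · have h1 : finRotate (m + 2) ^ (m + 2) = 1 := by
        ext x
        rw [SymPres.rot_pow]
        simp [Nat.mod_eq_of_lt x.2]
      have h2 := SymPres.tau_pow m
      rw [← ha] at h2
      simp only [map_mul, map_inv, map_pow, FreeGroup.lift_apply_of, f, if_true,
        Bool.false_eq_true, if_false, h1, show m + 2 - 1 = m + 1 by omega, h2]
      simp
    · simp only [map_pow, FreeGroup.lift_apply_of, f, if_true]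
      rw [pow_two, ha, Equiv.swap_mul_self]
  let F : PresentedGroup (symTwoGenRels (m + 2)) →* Equiv.Perm (Fin (m + 2)) :=
    PresentedGroup.toGroup hf
  have Ft : F (.of true) = a := by simp [F, f]
  have Ff : F (.of false) = finRotate (m + 2) := by simp [F, f]
  have hsurj : Function.Surjective F := by
    rw [← MonoidHom.range_eq_top, eq_top_iff]
    have h := Equiv.Perm.closure_cycle_adjacent_swap (σ := finRotate (m + 2)) isCycle_finRotate
      support_finRotate ⟨0, by omega⟩
    rw [← h, Subgroup.closure_le]
    rintro y (rfl | rfl)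
    · exact ⟨_, Ff⟩
    · refine ⟨.of true, ?_⟩
      rw [Ft, ha]
      congr 1
  set s : PresentedGroup (symTwoGenRels (m + 2)) := .of false with hs
  set t : PresentedGroup (symTwoGenRels (m + 2)) := .of true with ht
  have hin : ∀ x, x ∈ SymPres.T (SymPres.B s t) (m + 2 - 1) := by
    intro x
    refine SymPres.all_in (m + 2) hn s t ?_ ?_ ?_ ?_ x
    · exact PresentedGroup.one_of_mem (rels := symTwoGenRels (m + 2)) (Or.inr rfl)
    · have := PresentedGroup.one_of_mem (rels := symTwoGenRels (m + 2)) (Or.inl (Or.inr rfl))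
      rw [map_mul, map_inv, mul_inv_eq_one] at this
      exact this
    · intro i h2 hi
      have := PresentedGroup.one_of_mem (rels := symTwoGenRels (m + 2))
        (Or.inl (Or.inl ⟨i, h2, hi, rfl⟩))
      rw [map_mul, map_inv, mul_inv_eq_one] at this
      simp only [map_mul, map_inv, map_pow] at this
      simp only [SymPres.B, ← mul_assoc]
      exact this
    · rw [← PresentedGroup.closure_range_of]
      congr 1
      ext y
      simp [hs, ht, eq_comm]
  have hcard : Nat.card (PresentedGroup (symTwoGenRels (m + 2))) ≤ (m + 2).factorial := by
    have hfin : (Set.univ : Set (PresentedGroup (symTwoGenRels (m + 2)))) =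
        ↑(SymPres.T (SymPres.B s t) (m + 2 - 1)) := by
      ext x; simpa using hin x
    rw [← Set.ncard_univ, hfin, Set.ncard_coe_finset]
    exact SymPres.T_card _ (m + 1)
  haveI : Finite (PresentedGroup (symTwoGenRels (m + 2))) :=
    Finite.of_injective (fun x => (⟨x, hin x⟩ : SymPres.T (SymPres.B s t) (m + 2 - 1)))
      (fun x y h => by simpa using h)
  have hbij : Function.Bijective F := by
    refine (Nat.bijective_iff_surjective_and_card F).2 ⟨hsurj, ?_⟩
    refine le_antisymm ?_ (Nat.card_le_card_of_surjective F hsurj)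
    rw [Nat.card_perm, Nat.card_fin]
    exact hcard
  exact ⟨MulEquiv.ofBijective F hbij, Ft, Ff⟩
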